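/- Let j ∈ ℤ and p ∈ ℝ. Let h : [0,∞) → ℝ with h ∈ E be twice continuously differentiable on (0,∞) and an eigenfunction of D_j² with eigenvalue p on (0,∞), i.e., (1−j) h′(x) + x h″(x) = p h(x) for all x > 0. Then for each x > 0 and each constant c > 0, the asymptotic relation (S_{n,j} h)(x) = e^{p/n} h(x) + o(n^{−c}) holds as n → ∞. -/

import Mathlib

open MeasureTheory Real Filter Asymptotics

/-- The basis functions `s_{n,k}(x) = (nx)^k / k! · e^{-nx}` for `k ≥ 0`, and `0` for `k < 0`. -/
noncomputable def szk (n : ℝ) (k : ℤ) (x : ℝ) : ℝ :=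
  if k < 0 then 0 else (n * x) ^ k.toNat / (Nat.factorial k.toNat) * Real.exp (-n * x)

/-- Membership in `E_A`: locally integrable on `[0,∞)` and `|f t| ≤ K e^{A t}` for some `K > 0`. -/
def MemEA (A : ℝ) (f : ℝ → ℝ) : Prop :=
  LocallyIntegrableOn f (Set.Ici 0) volume ∧ ∃ K > 0, ∀ t ≥ (0:ℝ), |f t| ≤ K * Real.exp (A * t)

/-- The Szász-Mirakjan-Durrmeyer type operator `S_{n,j}`. -/
noncomputable def Snj (n : ℝ) (j : ℤ) (f : ℝ → ℝ) (x : ℝ) : ℝ :=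
  f 0 * ∑ k ∈ Finset.range j.toNat, szk n k x
    + ∑' k : ℕ, szk n (max 0 j + k) x *
        (n * ∫ t in Set.Ioi (0:ℝ), szk n (max 0 j + k - j) t * f t)

theorem szk_of_neg {k : ℤ} (hk : k < 0) (y x : ℝ) : szk y k x = 0 := if_pos hk

theorem szk_natCast (y : ℝ) (k : ℕ) (x : ℝ) :
    szk y k x = (y * x) ^ k / k.factorial * Real.exp (-y * x) := by
  simp [szk]

theorem szk_eq_szk_one (y : ℝ) (k : ℤ) (x : ℝ) : szk y k x = szk 1 k (y * x) := by
  simp [szk]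

theorem szk_nonneg {y x : ℝ} (hy : 0 ≤ y) (hx : 0 ≤ x) (k : ℤ) : 0 ≤ szk y k x := by
  unfold szk
  split_ifs <;> positivity

theorem szk_le_one {y x : ℝ} (hy : 0 ≤ y) (hx : 0 ≤ x) (k : ℤ) : szk y k x ≤ 1 := by
  unfold szk
  split_ifs with hk
  · exact zero_le_one
  · calc _ ≤ Real.exp (y * x) * Real.exp (-y * x) := by
          gcongr
          exact Real.pow_div_factorial_le_exp _ (by positivity) _
      _ = 1 := by rw [← Real.exp_add]; simp

theorem mul_szk (y : ℝ) (k : ℤ) (x : ℝ) : y * x * szk y k x = (k + 1) * szk y (k + 1) x := by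
  rcases lt_or_ge k 0 with hk | hk
  · rw [szk_of_neg hk]
    rcases eq_or_lt_of_le (show k + 1 ≤ 0 by omega) with h1 | h1
    · have : (k : ℝ) + 1 = 0 := by exact_mod_cast h1
      simp [this]
    · simp [szk_of_neg h1]
  · lift k to ℕ using hk
    have := szk_natCast y (k + 1) x
    push_cast at this
    rw [this, szk_natCast, Nat.factorial_succ]
    push_cast
    have : (k.factorial : ℝ) ≠ 0 := by positivity
    have : (k : ℝ) + 1 ≠ 0 := by positivity
    field_simp
    ring

theorem hasDerivAt_szk_one (k : ℤ) (u : ℝ) :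
    HasDerivAt (szk 1 k) (szk 1 (k - 1) u - szk 1 k u) u := by
  have hexp : HasDerivAt (fun u : ℝ => Real.exp (-1 * u)) (-Real.exp (-1 * u)) u := by
    simpa using ((hasDerivAt_id u).const_mul (-1 : ℝ)).exp
  rcases lt_or_ge k 0 with hk | hk
  · have : szk 1 k = fun _ => 0 := funext fun x => szk_of_neg hk 1 x
    rw [this, szk_of_neg (by omega)]
    simpa using hasDerivAt_const u (0 : ℝ)
  · lift k to ℕ using hk
    have : szk 1 k = fun x => x ^ k / k.factorial * Real.exp (-1 * x) := by
      funext x; rw [szk_natCast, one_mul]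
    rw [this]
    convert! ((hasDerivAt_pow k u).div_const (k.factorial : ℝ)).mul hexp using 1
    rcases k with _ | k
    · simp [szk_of_neg]
    · have := szk_natCast 1 k u
      push_cast
      rw [add_sub_cancel_right, this, Nat.factorial_succ]
      push_cast
      have : (k.factorial : ℝ) ≠ 0 := by positivity
      have : (k : ℝ) + 1 ≠ 0 := by positivity
      simp
      field_simp
      ring

theorem hasDerivAt_szk (y : ℝ) (k : ℤ) (x : ℝ) :
    HasDerivAt (szk y k) (y * (szk y (k - 1) x - szk y k x)) x := by
  have h : HasDerivAt (fun x => szk 1 k (y * x)) _ x :=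
    (hasDerivAt_szk_one k (y * x)).comp x ((hasDerivAt_id x).const_mul y)
  simp only [← szk_eq_szk_one, mul_one] at h
  rw [mul_comm]
  exact h

theorem hasDerivAt_szk_left (y : ℝ) (k : ℤ) (x : ℝ) :
    HasDerivAt (fun y => szk y k x) (x * (szk y (k - 1) x - szk y k x)) y := by
  have h := HasDerivAt.comp (h₂ := szk 1 k) (h := fun y => y * x) y
    (hasDerivAt_szk_one k (y * x)) ((hasDerivAt_id y).mul_const x)
  simp only [← szk_eq_szk_one, one_mul] at h
  rw [mul_comm]
  exact h.congr_of_eventuallyEq (Eventually.of_forall fun y => szk_eq_szk_one y k x)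

theorem continuous_szk (y : ℝ) (k : ℤ) : Continuous (szk y k) :=
  continuous_iff_continuousAt.2 fun x => (hasDerivAt_szk y k x).continuousAt

theorem hasSum_szk_mul_pow (y x r : ℝ) :
    HasSum (fun k : ℕ => szk y k x * r ^ k) (Real.exp (y * x * (r - 1))) := by
  have h := (NormedSpace.expSeries_div_hasSum_exp (y * x * r)).mul_right (Real.exp (-y * x))
  rw [← Real.exp_eq_exp_ℝ, ← Real.exp_add] at h
  convert! h using 1
  · funext k
    rw [szk_natCast]
    ring
  · ring_nf

theorem integrableOn_szk_mul_exp {y θ : ℝ} (hθ : θ < y) (k : ℤ) :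
    IntegrableOn (fun t => szk y k t * Real.exp (θ * t)) (Set.Ioi 0) := by
  rcases lt_or_ge k 0 with hk | hk
  · simp [szk_of_neg hk]
  lift k to ℕ using hk
  have h := (integrableOn_rpow_mul_exp_neg_mul_rpow (p := 1) (s := k) (b := y - θ)
    (by have : (0 : ℝ) ≤ k := by positivity
        linarith) one_pos (by linarith)).const_mul (y ^ k / k.factorial)
  refine h.congr (Eventually.of_forall fun t => ?_)
  simp only [szk_natCast, rpow_one, rpow_natCast]
  rw [mul_assoc (_ / _), ← Real.exp_add, mul_pow, show -(y - θ) * t = -y * t + θ * t by ring]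
  ring

/-- The weighted mean `y ∫₀^∞ s_{y,k}(t) f(t) dt`. -/
noncomputable def szkMoment (y : ℝ) (k : ℤ) (f : ℝ → ℝ) : ℝ :=
  y * ∫ t in Set.Ioi (0 : ℝ), szk y k t * f t

theorem szkMoment_of_neg {k : ℤ} (hk : k < 0) (y : ℝ) (f : ℝ → ℝ) : szkMoment y k f = 0 := by
  simp [szkMoment, szk_of_neg hk]

theorem szkMoment_exp {y θ : ℝ} (hθ : θ < y) {k : ℤ} (hk : 0 ≤ k) :
    szkMoment y k (fun t => Real.exp (θ * t)) = (y / (y - θ)) ^ (k + 1) := by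
  lift k to ℕ using hk
  have h := Real.integral_rpow_mul_exp_neg_mul_Ioi (a := k + 1) (r := y - θ) (by positivity)
    (by linarith)
  have h2 : ∫ t in Set.Ioi (0 : ℝ), szk y k t * Real.exp (θ * t)
      = (y ^ k / k.factorial) *
        ∫ t in Set.Ioi (0 : ℝ), t ^ ((k : ℝ) + 1 - 1) * Real.exp (-((y - θ) * t)) := by
    rw [← integral_const_mul]
    congr 1 with t
    rw [szk_natCast, add_sub_cancel_right, rpow_natCast, mul_assoc (_ / _), ← Real.exp_add,
      mul_pow, show -((y - θ) * t) = -y * t + θ * t by ring]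
    ring
  rw [szkMoment, h2, h, Real.Gamma_nat_eq_factorial]
  have : (k.factorial : ℝ) ≠ 0 := by positivity
  rw [show (k : ℝ) + 1 = ((k + 1 : ℕ) : ℝ) by push_cast; ring, rpow_natCast,
    show (k : ℤ) + 1 = ((k + 1 : ℕ) : ℤ) by push_cast; ring, zpow_natCast,
    div_pow, div_pow, one_pow, pow_succ y]
  field_simp

theorem szkMoment_add {y : ℝ} {k : ℤ} {f g : ℝ → ℝ}
    (hf : IntegrableOn (fun t => szk y k t * f t) (Set.Ioi 0))
    (hg : IntegrableOn (fun t => szk y k t * g t) (Set.Ioi 0)) :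
    szkMoment y k (fun t => f t + g t) = szkMoment y k f + szkMoment y k g := by
  simp only [szkMoment, mul_add]
  rw [integral_add hf hg, mul_add]

theorem szkMoment_const_mul (y : ℝ) (k : ℤ) (a : ℝ) (f : ℝ → ℝ) :
    szkMoment y k (fun t => a * f t) = a * szkMoment y k f := by
  simp only [szkMoment, mul_left_comm _ a]
  rw [integral_const_mul, mul_left_comm]

theorem abs_szkMoment_le {y : ℝ} (hy : 0 ≤ y) {k : ℤ} {f F : ℝ → ℝ}
    (hF : IntegrableOn (fun t => szk y k t * F t) (Set.Ioi 0)) (h : ∀ t > 0, |f t| ≤ F t) :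
    |szkMoment y k f| ≤ szkMoment y k F := by
  unfold szkMoment
  rw [abs_mul, abs_of_nonneg hy]
  refine mul_le_mul_of_nonneg_left ((Real.norm_eq_abs _).ge.trans
    (norm_integral_le_of_norm_le hF ?_)) hy
  filter_upwards [ae_restrict_mem measurableSet_Ioi] with t ht
  rw [norm_mul, Real.norm_eq_abs, Real.norm_eq_abs, abs_of_nonneg (szk_nonneg hy (le_of_lt ht) k)]
  exact mul_le_mul_of_nonneg_left (h t ht) (szk_nonneg hy (le_of_lt ht) k)

theorem abs_szkMoment_le_of_bounded {y : ℝ} (hy : 0 < y) (k : ℤ) {f : ℝ → ℝ} {M : ℝ} (hM : 0 ≤ M)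
    (h : ∀ t > 0, |f t| ≤ M) : |szkMoment y k f| ≤ M := by
  rcases lt_or_ge k 0 with hk | hk
  · simpa [szkMoment_of_neg hk] using hM
  have h0 := szkMoment_exp hy hk
  have hi := (integrableOn_szk_mul_exp hy k).const_mul M
  refine (abs_szkMoment_le hy.le (F := fun t => M * Real.exp (0 * t)) ?_ (by simpa using h)).trans ?_
  · simpa only [IntegrableOn, mul_left_comm] using hi
  · rw [szkMoment_const_mul, h0, sub_zero, div_self hy.ne', one_zpow, mul_one]

/-- The `m`-th term of the series in the definition of `Snj`. -/
noncomputable def szkTerm (y : ℝ) (j : ℤ) (x : ℝ) (f : ℝ → ℝ) (m : ℕ) : ℝ :=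
  szk y (max 0 j + m) x * szkMoment y (max 0 j + m - j) f

theorem Snj_eq (y : ℝ) (j : ℤ) (f : ℝ → ℝ) (x : ℝ) :
    Snj y j f x = f 0 * ∑ k ∈ Finset.range j.toNat, szk y k x + ∑' m, szkTerm y j x f m := rfl

/-- All integrals and the series occurring in `Snj y j f x` converge. -/
def SzkSummable (y : ℝ) (j : ℤ) (x : ℝ) (f : ℝ → ℝ) : Prop :=
  (∀ k, IntegrableOn (fun t => szk y k t * f t) (Set.Ioi 0)) ∧ Summable (szkTerm y j x f)

theorem szkTerm_exp {y θ : ℝ} (hθ : θ < y) (hy : 0 < y) (j : ℤ) (x : ℝ) (m : ℕ) :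
    szkTerm y j x (fun t => Real.exp (θ * t)) m =
      (y / (y - θ)) ^ (1 - j) * (szk y ((m + j.toNat : ℕ) : ℤ) x *
        (y / (y - θ)) ^ (m + j.toNat)) := by
  have hr : y / (y - θ) ≠ 0 := (div_pos hy (by linarith)).ne'
  have e : max 0 j + (m : ℤ) = ((m + j.toNat : ℕ) : ℤ) := by push_cast; omega
  rw [szkTerm, szkMoment_exp hθ (by omega), e,
    show ((m + j.toNat : ℕ) : ℤ) - j + 1 = (1 - j) + ((m + j.toNat : ℕ) : ℤ) by ring,
    zpow_add₀ hr, zpow_natCast]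
  ring

theorem szkSummable_exp {y θ : ℝ} (hθ : θ < y) (hy : 0 < y) (j : ℤ) (x : ℝ) :
    SzkSummable y j x (fun t => Real.exp (θ * t)) := by
  refine ⟨integrableOn_szk_mul_exp hθ, ?_⟩
  simp only [funext (szkTerm_exp hθ hy j x)]
  exact ((summable_nat_add_iff j.toNat).2 (hasSum_szk_mul_pow y x _).summable).mul_left _

theorem tsum_szkTerm_exp_le {y θ x : ℝ} (hθ : θ < y) (hy : 0 < y) (hx : 0 ≤ x) (j : ℤ) :
    ∑' m, szkTerm y j x (fun t => Real.exp (θ * t)) m ≤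
      (y / (y - θ)) ^ (1 - j) * Real.exp (y * x * (y / (y - θ) - 1)) := by
  have hr : 0 < y / (y - θ) := div_pos hy (by linarith)
  simp only [funext (szkTerm_exp hθ hy j x)]
  have h := hasSum_szk_mul_pow y x (y / (y - θ))
  rw [tsum_mul_left, ← h.tsum_eq, ← h.summable.sum_add_tsum_nat_add j.toNat]
  gcongr
  refine le_add_of_nonneg_left (Finset.sum_nonneg fun k _ => ?_)
  exact mul_nonneg (szk_nonneg hy.le hx _) (by positivity)

theorem SzkSummable.add {y : ℝ} {j : ℤ} {x : ℝ} {f g : ℝ → ℝ} (hf : SzkSummable y j x f)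
    (hg : SzkSummable y j x g) :
    SzkSummable y j x (fun t => f t + g t) ∧
      ∑' m, szkTerm y j x (fun t => f t + g t) m =
        ∑' m, szkTerm y j x f m + ∑' m, szkTerm y j x g m := by
  have e : szkTerm y j x (fun t => f t + g t) =
      fun m => szkTerm y j x f m + szkTerm y j x g m := by
    funext m
    rw [szkTerm, szkMoment_add (hf.1 _) (hg.1 _), mul_add]
    rfl
  refine ⟨⟨fun k => ?_, ?_⟩, ?_⟩
  · simp only [mul_add]
    exact (hf.1 k).add (hg.1 k)
  · rw [e]
    exact hf.2.add hg.2
  · rw [e, hf.2.tsum_add hg.2]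

theorem szkTerm_const_mul (y : ℝ) (j : ℤ) (x a : ℝ) (f : ℝ → ℝ) (m : ℕ) :
    szkTerm y j x (fun t => a * f t) m = a * szkTerm y j x f m := by
  rw [szkTerm, szkMoment_const_mul, mul_left_comm]
  rfl

theorem SzkSummable.const_mul {y : ℝ} {j : ℤ} {x : ℝ} {f : ℝ → ℝ} (hf : SzkSummable y j x f)
    (a : ℝ) : SzkSummable y j x (fun t => a * f t) := by
  refine ⟨fun k => ?_, ?_⟩
  · simp only [mul_left_comm _ a]
    exact (hf.1 k).const_mul a
  · simp only [funext (szkTerm_const_mul y j x a f)]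
    exact hf.2.mul_left a

theorem SzkSummable.of_abs_le {y : ℝ} (hy : 0 ≤ y) {j : ℤ} {x : ℝ} (hx : 0 ≤ x) {f F : ℝ → ℝ}
    (hF : SzkSummable y j x F) (hf : AEStronglyMeasurable f (volume.restrict (Set.Ioi 0)))
    (h : ∀ t > 0, |f t| ≤ F t) :
    SzkSummable y j x f ∧ |∑' m, szkTerm y j x f m| ≤ ∑' m, szkTerm y j x F m := by
  have hle : ∀ m, ‖szkTerm y j x f m‖ ≤ szkTerm y j x F m := fun m => by
    rw [szkTerm, norm_mul, Real.norm_eq_abs, Real.norm_eq_abs, abs_of_nonneg (szk_nonneg hy hx _)]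
    exact mul_le_mul_of_nonneg_left (abs_szkMoment_le hy (hF.1 _) h) (szk_nonneg hy hx _)
  refine ⟨⟨fun k => ?_, .of_norm_bounded hF.2 hle⟩, tsum_of_norm_bounded hF.2.hasSum hle⟩
  refine (hF.1 k).mono' ((continuous_szk y k).aestronglyMeasurable.mul hf) ?_
  filter_upwards [ae_restrict_mem measurableSet_Ioi] with t ht
  rw [norm_mul, Real.norm_eq_abs, Real.norm_eq_abs, abs_of_nonneg (szk_nonneg hy (le_of_lt ht) k)]
  exact mul_le_mul_of_nonneg_left (h t ht) (szk_nonneg hy (le_of_lt ht) k)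

theorem szkSummable_of_abs_le_exp {y A K x : ℝ} (hy : 0 < y) (hA : A < y) (hx : 0 ≤ x) (j : ℤ)
    {f : ℝ → ℝ} (hf : AEStronglyMeasurable f (volume.restrict (Set.Ioi 0)))
    (h : ∀ t > 0, |f t| ≤ K * Real.exp (A * t)) : SzkSummable y j x f :=
  (((szkSummable_exp hA hy j x).const_mul K).of_abs_le hy.le hx hf h).1

/-- A function of exponential growth vanishing near `x` contributes exponentially little. -/
theorem exists_abs_tsum_szkTerm_le {A K x δ : ℝ} (hx : 0 < x) (hδ : 0 < δ) (hA : 0 ≤ A) (hK : 0 ≤ K)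
    (j : ℤ) {f : ℝ → ℝ} (hf : AEStronglyMeasurable f (volume.restrict (Set.Ioi 0)))
    (h : ∀ t > 0, |f t| ≤ K * Real.exp (A * t)) (h0 : ∀ t, |t - x| < δ → f t = 0) :
    ∃ C κ : ℝ, 0 < κ ∧ ∀ᶠ y : ℝ in atTop,
      |∑' m, szkTerm y j x f m| ≤ C * Real.exp (-κ * y) := by
  obtain ⟨η, hη, hη1, hη2⟩ : ∃ η > 0, η ≤ 1 / 2 ∧ x * η ≤ δ / 4 := by
    refine ⟨min (1 / 2) (δ / (4 * x)), by positivity, min_le_left _ _, ?_⟩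
    calc x * min (1 / 2) (δ / (4 * x)) ≤ x * (δ / (4 * x)) := by gcongr; exact min_le_right _ _
      _ = δ / 4 := by field_simp
  set K' := K * Real.exp (A * (x + δ)) with hK'
  have hK'0 : 0 ≤ K' := by positivity
  refine ⟨K' * (1 / (1 - η)) ^ (1 - j) + K' * (1 / (1 + η)) ^ (1 - j), η * δ / 2, by positivity, ?_⟩
  filter_upwards [eventually_ge_atTop (A / η), eventually_gt_atTop 0] with y hyA hy
  have hyA' : A ≤ η * y := by rwa [div_le_iff₀ hη, mul_comm] at hyA
  have hθ1 : η * y < y := by nlinarith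
  have hθ2 : -(η * y) < y := by nlinarith [mul_pos hη hy]
  have hr1 : y / (y - η * y) = 1 / (1 - η) := by
    rw [show y - η * y = y * (1 - η) by ring]
    have : 1 - η ≠ 0 := by linarith
    field_simp
  have hr2 : y / (y - -(η * y)) = 1 / (1 + η) := by
    rw [show y - -(η * y) = y * (1 + η) by ring]
    have : 1 + η ≠ 0 := by linarith
    field_simp
  have s1 := szkSummable_exp hθ1 hy j x
  have s2 := szkSummable_exp hθ2 hy j x
  have b1 := tsum_szkTerm_exp_le hθ1 hy hx.le j
  have b2 := tsum_szkTerm_exp_le hθ2 hy hx.le j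
  rw [hr1] at b1
  rw [hr2] at b2
  set c1 := K' * Real.exp (-(η * y) * (x + δ)) with hc1
  set c2 := K' * Real.exp (η * y * (x - δ)) with hc2
  obtain ⟨s, e⟩ := (s1.const_mul c1).add (s2.const_mul c2)
  have hdom : ∀ t > 0, |f t| ≤ c1 * Real.exp (η * y * t) + c2 * Real.exp (-(η * y) * t) := by
    intro t ht
    have e : c1 * Real.exp (η * y * t) + c2 * Real.exp (-(η * y) * t) =
        K * Real.exp (A * (x + δ) + η * y * (t - x - δ)) +
          K * Real.exp (A * (x + δ) + η * y * (x - δ - t)) := by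
      rw [hc1, hc2, hK', show η * y * (t - x - δ) = -(η * y) * (x + δ) + η * y * t by ring,
        show η * y * (x - δ - t) = η * y * (x - δ) + -(η * y) * t by ring]
      simp only [Real.exp_add (_ * (x + δ)), Real.exp_add (_ * (x - δ))]
      ring
    rw [e]
    by_cases hn : |t - x| < δ
    · rw [h0 t hn, abs_zero]
      positivity
    · rcases le_abs'.1 (not_lt.1 hn) with h1 | h1
      · refine (h t ht).trans (le_trans ?_ (le_add_of_nonneg_left (by positivity)))
        gcongr
        nlinarith [mul_nonneg hA (by linarith : 0 ≤ x + δ - t),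
          mul_nonneg (mul_pos hη hy).le (by linarith : 0 ≤ x - δ - t)]
      · refine (h t ht).trans (le_trans ?_ (le_add_of_nonneg_right (by positivity)))
        gcongr
        nlinarith [mul_nonneg (sub_nonneg.2 hyA') (by linarith : 0 ≤ t - x - δ)]
  refine (s.of_abs_le hy.le hx.le hf hdom).2.trans ?_
  rw [e]
  simp only [szkTerm_const_mul, tsum_mul_left]
  have p1 : (0 : ℝ) ≤ (1 / (1 - η)) ^ (1 - j) := by
    have : 0 < 1 - η := by linarith
    positivity
  have p2 : (0 : ℝ) ≤ (1 / (1 + η)) ^ (1 - j) := by positivity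
  have q1 : -(η * y) * (x + δ) + y * x * (1 / (1 - η) - 1) ≤ -(η * δ / 2) * y := by
    have : 1 / (1 - η) - 1 ≤ η * (1 + 2 * η) := by
      rw [div_sub_one (by linarith), div_le_iff₀ (by linarith)]
      nlinarith [mul_nonneg hη.le hη.le]
    nlinarith [mul_le_mul_of_nonneg_left this (mul_pos hy hx).le,
      mul_le_mul_of_nonneg_left hη2 (mul_pos hη hy).le]
  have q2 : η * y * (x - δ) + y * x * (1 / (1 + η) - 1) ≤ -(η * δ / 2) * y := by
    have : 1 / (1 + η) - 1 ≤ -η + η * η := by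
      rw [div_sub_one (by linarith), div_le_iff₀ (by linarith)]
      nlinarith [mul_pos (mul_pos hη hη) hη]
    nlinarith [mul_le_mul_of_nonneg_left this (mul_pos hy hx).le,
      mul_le_mul_of_nonneg_left hη2 (mul_pos hη hy).le, mul_pos (mul_pos hη hy) hδ]
  rw [add_mul]
  refine add_le_add ?_ ?_
  · refine (mul_le_mul_of_nonneg_left b1 (by positivity)).trans ?_
    calc _ = K' * (1 / (1 - η)) ^ (1 - j) *
        Real.exp (-(η * y) * (x + δ) + y * x * (1 / (1 - η) - 1)) := by
          rw [hc1, Real.exp_add]; ring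
      _ ≤ _ := by gcongr
  · refine (mul_le_mul_of_nonneg_left b2 (by positivity)).trans ?_
    calc _ = K' * (1 / (1 + η)) ^ (1 - j) *
        Real.exp (η * y * (x - δ) + y * x * (1 / (1 + η) - 1)) := by
          rw [hc2, Real.exp_add]; ring
      _ ≤ _ := by gcongr

theorem szk_isLittleO (k : ℕ) {x : ℝ} (hx : 0 < x) (c : ℝ) :
    (fun y => szk y k x) =o[atTop] fun y : ℝ => y ^ (-c) := by
  have h := (isBigO_refl (fun y : ℝ => y ^ k) atTop).mul_isLittleO
    (isLittleO_exp_neg_mul_rpow_atTop hx (-c - k))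
  refine ((h.const_mul_left (x ^ k / k.factorial)).congr' ?_ ?_)
  · refine Eventually.of_forall fun y => ?_
    simp only [szk_natCast, mul_pow, show -x * y = -y * x by ring]
    ring
  · filter_upwards [eventually_gt_atTop 0] with y hy
    rw [← rpow_natCast, ← rpow_add hy]
    ring_nf

theorem sum_szk_isLittleO (N : ℕ) {x : ℝ} (hx : 0 < x) (c : ℝ) :
    (fun y => ∑ k ∈ Finset.range N, szk y (k : ℤ) x) =o[atTop] fun y : ℝ => y ^ (-c) :=
  (IsLittleO.sum (s := Finset.range N) fun k _ => szk_isLittleO k hx c).congr_left fun y => by simp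

theorem tendsto_tsum_szkTerm_one {x : ℝ} (hx : 0 < x) (j : ℤ) :
    Tendsto (fun y => ∑' m, szkTerm y j x (fun t => Real.exp (0 * t)) m) atTop (nhds 1) := by
  have h0 : Tendsto (fun y => ∑ k ∈ Finset.range j.toNat, szk y (k : ℤ) x) atTop (nhds 0) := by
    simpa using sum_szk_isLittleO j.toNat hx 0
  have h1 := h0.const_sub 1
  rw [sub_zero] at h1
  refine h1.congr' ?_
  filter_upwards [eventually_gt_atTop 0] with y hy
  have h := hasSum_szk_mul_pow y x 1
  have h2 := h.summable.sum_add_tsum_nat_add j.toNat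
  rw [h.tsum_eq] at h2
  simp only [one_pow, mul_one, sub_self, mul_zero, Real.exp_zero] at h2
  simp only [szkTerm_exp hy hy, sub_zero, div_self hy.ne', one_zpow, one_pow, one_mul, mul_one]
  linarith

theorem tendsto_tsum_szkTerm {x M : ℝ} (hx : 0 < x) (j : ℤ) {g : ℝ → ℝ} (hg : Continuous g)
    (hM : ∀ t, |g t| ≤ M) :
    Tendsto (fun y => ∑' m, szkTerm y j x g m) atTop (nhds (g x)) := by
  have hM0 : 0 ≤ M := (abs_nonneg _).trans (hM 0)
  have hsub : Tendsto (fun y => ∑' m, szkTerm y j x (fun t => g t - g x) m) atTop (nhds 0) := by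
    rw [Metric.tendsto_nhds]
    intro ε hε
    obtain ⟨δ, hδ, hclose⟩ := Metric.continuous_iff.1 hg x (ε / 2) (by positivity)
    set s : Set ℝ := Metric.ball x δ with hs
    have hsm : MeasurableSet s := measurableSet_ball
    have hm : Continuous fun t => g t - g x := by fun_prop
    set f1 := s.indicator fun t => g t - g x with hf1
    set f2 := sᶜ.indicator fun t => g t - g x with hf2
    have hf1m : AEStronglyMeasurable f1 (volume.restrict (Set.Ioi 0)) :=
      hm.aestronglyMeasurable.indicator hsm
    have hf2m : AEStronglyMeasurable f2 (volume.restrict (Set.Ioi 0)) :=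
      hm.aestronglyMeasurable.indicator hsm.compl
    have hb1 : ∀ t, |f1 t| ≤ ε / 2 * Real.exp (0 * t) := by
      intro t
      rw [zero_mul, Real.exp_zero, mul_one]
      by_cases ht : t ∈ s
      · rw [hf1, Set.indicator_of_mem ht]
        exact (hclose t ht).le
      · rw [hf1, Set.indicator_of_notMem ht, abs_zero]
        positivity
    have hb2 : ∀ t, |f2 t| ≤ 2 * M * Real.exp (0 * t) := by
      intro t
      rw [zero_mul, Real.exp_zero, mul_one]
      by_cases ht : t ∈ sᶜ
      · rw [hf2, Set.indicator_of_mem ht]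
        refine (abs_sub _ _).trans ?_
        linarith [hM t, hM x]
      · rw [hf2, Set.indicator_of_notMem ht, abs_zero]
        positivity
    obtain ⟨C, κ, hκ, hC⟩ := exists_abs_tsum_szkTerm_le hx hδ le_rfl (by positivity) j hf2m
      (fun t _ => hb2 t) (fun t ht => Set.indicator_of_notMem (by
        simpa [hs, Real.dist_eq] using ht) _)
    have hlim : Tendsto (fun y => C * Real.exp (-κ * y)) atTop (nhds 0) := by
      have := (isLittleO_exp_neg_mul_rpow_atTop hκ 0).const_mul_left C
      simpa using this
    filter_upwards [hC, eventually_gt_atTop 0, hlim.eventually_lt_const (half_pos hε)] with y h1 hy h2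
    have hs1 := (((szkSummable_exp hy hy j x).const_mul (ε / 2)).of_abs_le hy.le hx.le hf1m
      fun t _ => hb1 t)
    have hs2 := szkSummable_of_abs_le_exp hy hy hx.le j hf2m fun t _ => hb2 t
    have hsum := (hs1.1.add hs2).2
    have heq : (fun t => f1 t + f2 t) = fun t => g t - g x :=
      Set.indicator_self_add_compl s fun t => g t - g x
    rw [heq] at hsum
    rw [Real.dist_eq, sub_zero, hsum]
    have hE := tsum_szkTerm_exp_le hy hy hx.le j
    rw [sub_zero, div_self hy.ne', one_zpow, sub_self, mul_zero, Real.exp_zero, one_mul] at hE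
    have hE2 := hs1.2
    simp only [szkTerm_const_mul, tsum_mul_left] at hE2
    refine (abs_add_le _ _).trans_lt ?_
    nlinarith
  have h1 := hsub.add ((tendsto_tsum_szkTerm_one hx j).const_mul (g x))
  rw [zero_add, mul_one] at h1
  refine h1.congr' ?_
  filter_upwards [eventually_gt_atTop 0] with y hy
  have hs1 : SzkSummable y j x fun t => g t - g x :=
    szkSummable_of_abs_le_exp (K := 2 * M) hy hy hx.le j (by fun_prop) fun t _ => by
      rw [zero_mul, Real.exp_zero, mul_one]
      refine (abs_sub _ _).trans ?_
      linarith [hM t, hM x]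
  have hsum := (hs1.add ((szkSummable_exp hy hy j x).const_mul (g x))).2
  simp only [szkTerm_const_mul, tsum_mul_left] at hsum
  rw [← hsum]
  simp

/-- The differential operator `D_j²`. -/
noncomputable def opD (j : ℤ) (f : ℝ → ℝ) (t : ℝ) : ℝ :=
  (1 - j) * deriv f t + t * deriv (deriv f) t

theorem setIntegral_Ioi_eq_of_tsupport_subset {φ g : ℝ → ℝ} (hg : tsupport g ⊆ Set.Ioi 0) :
    ∫ t in Set.Ioi (0 : ℝ), φ t * g t = ∫ t, φ t * g t := by
  refine setIntegral_eq_integral_of_forall_compl_eq_zero fun t ht => ?_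
  rw [image_eq_zero_of_notMem_tsupport fun h => ht (hg h), mul_zero]

theorem tsupport_opD_subset (j : ℤ) (g : ℝ → ℝ) : tsupport (opD j g) ⊆ tsupport g := by
  refine closure_minimal (fun t ht => ?_) (isClosed_tsupport g)
  by_contra hn
  refine ht ?_
  have h1 : deriv g t = 0 := image_eq_zero_of_notMem_tsupport fun h => hn (tsupport_deriv_subset h)
  have h2 : deriv (deriv g) t = 0 := image_eq_zero_of_notMem_tsupport fun h =>
    hn (tsupport_deriv_subset (tsupport_deriv_subset h))
  simp [opD, h1, h2]

theorem continuous_opD (j : ℤ) {g : ℝ → ℝ} (hg : ContDiff ℝ 2 g) : Continuous (opD j g) := by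
  have h1 : Continuous (deriv g) := hg.continuous_deriv (by norm_num)
  have h2 : Continuous (deriv (deriv g)) := by
    have : ContDiff ℝ 1 (deriv g) := ContDiff.deriv' (n := 1) (by simpa [one_add_one_eq_two] using hg)
    exact this.continuous_deriv le_rfl
  unfold opD
  fun_prop

theorem integrable_mul_of_hasCompactSupport {φ g : ℝ → ℝ} (hφ : Continuous φ) (hg : Continuous g)
    (hc : HasCompactSupport g) : Integrable fun t => φ t * g t :=
  (hφ.mul hg).integrable_of_hasCompactSupport hc.mul_left

theorem szkMoment_opD (y : ℝ) (k j : ℤ) {g : ℝ → ℝ} (hg : ContDiff ℝ 2 g)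
    (hc : HasCompactSupport g) (hs : tsupport g ⊆ Set.Ioi 0) :
    szkMoment y k (opD j g) = y * ((k + j) * szkMoment y (k - 1) g
      - (2 * k + 1 + j) * szkMoment y k g + (k + 1) * szkMoment y (k + 1) g) := by
  have hd1 : ∀ t, HasDerivAt g (deriv g t) t := fun t =>
    (hg.differentiable (by norm_num) t).hasDerivAt
  have hg1 : ContDiff ℝ 1 (deriv g) :=
    ContDiff.deriv' (n := 1) (by simpa [one_add_one_eq_two] using hg)
  have hd2 : ∀ t, HasDerivAt (deriv g) (deriv (deriv g) t) t := fun t =>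
    (hg1.differentiable (by norm_num) t).hasDerivAt
  have hi : ∀ l, Integrable fun t => szk y l t * g t := fun l =>
    integrable_mul_of_hasCompactSupport (continuous_szk y l) hg.continuous hc
  have hD : Integrable fun t => szk y k t * opD j g t :=
    integrable_mul_of_hasCompactSupport (continuous_szk y k) (continuous_opD j hg)
      (hc.mono' (subset_closure.trans (tsupport_opD_subset j g)))
  set W : ℝ → ℝ := fun t => (t * szk y k t) * deriv g t
    + ((1 - j) * szk y k t - (k + 1) * (szk y k t - szk y (k + 1) t)) * g t with hW
  set adj : ℝ → ℝ := fun t => y * ((k + j) * (szk y (k - 1) t * g t)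
    - (2 * k + 1 + j) * (szk y k t * g t) + (k + 1) * (szk y (k + 1) t * g t)) with hadj
  have hWi : Integrable W := by
    have hk := continuous_szk y k
    have hk1 := continuous_szk y (k + 1)
    exact (integrable_mul_of_hasCompactSupport (by fun_prop) hg1.continuous hc.deriv).add
      (integrable_mul_of_hasCompactSupport (by fun_prop) hg.continuous hc)
  have hadji : Integrable adj :=
    ((((hi _).const_mul _).sub ((hi _).const_mul _)).add ((hi _).const_mul _)).const_mul y
  have hWd : ∀ t, HasDerivAt W (szk y k t * opD j g t - adj t) t := by
    intro t
    have e1 := hasDerivAt_szk y k t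
    have e2 := hasDerivAt_szk y (k + 1) t
    rw [add_sub_cancel_right] at e2
    convert! (((hasDerivAt_id t).mul e1).mul (hd2 t)).add
      (((e1.const_mul (1 - j : ℝ)).sub ((e1.sub e2).const_mul (k + 1 : ℝ))).mul (hd1 t)) using 1
    have m1 := mul_szk y (k - 1) t
    have m2 := mul_szk y k t
    simp only [sub_add_cancel, Int.cast_sub, Int.cast_one] at m1
    simp only [hadj, opD, id, Pi.mul_apply, Pi.sub_apply]
    linear_combination (-deriv g t) * (m1 - m2)
  have key := integral_eq_zero_of_hasDerivAt_of_integrable hWd (hD.sub hadji) hWi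
  rw [integral_sub hD hadji, sub_eq_zero] at key
  have hadjI : ∫ t, adj t = y * ((k + j) * (∫ t, szk y (k - 1) t * g t)
      - (2 * k + 1 + j) * (∫ t, szk y k t * g t) + (k + 1) * ∫ t, szk y (k + 1) t * g t) := by
    have hsub : Integrable fun t =>
        (k + j) * (szk y (k - 1) t * g t) - (2 * k + 1 + j) * (szk y k t * g t) :=
      ((hi _).const_mul _).sub ((hi _).const_mul _)
    simp only [hadj]
    rw [integral_const_mul, integral_add hsub ((hi _).const_mul _), integral_sub ((hi _).const_mul _) ((hi _).const_mul _),
      integral_const_mul, integral_const_mul, integral_const_mul]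
  unfold szkMoment
  rw [setIntegral_Ioi_eq_of_tsupport_subset ((tsupport_opD_subset j g).trans hs), key, hadjI]
  simp only [setIntegral_Ioi_eq_of_tsupport_subset hs]
  ring

theorem hasDerivAt_szkMoment {y : ℝ} (hy : 0 < y) (k : ℤ) {g : ℝ → ℝ} (hg : Continuous g)
    (hc : HasCompactSupport g) :
    HasDerivAt (fun y => szkMoment y k g)
      ((k + 1) / y * (szkMoment y k g - szkMoment y (k + 1) g)) y := by
  have hi : ∀ z l, IntegrableOn (fun t => szk z l t * g t) (Set.Ioi 0) := fun z l =>
    (integrable_mul_of_hasCompactSupport (continuous_szk z l) hg hc).integrableOn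
  have hgi : IntegrableOn g (Set.Ioi 0) := (hg.integrable_of_hasCompactSupport hc).integrableOn
  have h := (hasDerivAt_integral_of_dominated_loc_of_deriv_le
    (μ := volume.restrict (Set.Ioi (0 : ℝ))) (s := Set.Ioi (0 : ℝ)) (x₀ := y)
    (F := fun z t => z * (szk z k t * g t))
    (F' := fun z t => (k + 1) * (szk z k t * g t - szk z (k + 1) t * g t))
    (bound := fun t => |(k + 1 : ℝ)| * (2 * |g t|)) (Ioi_mem_nhds hy)
    (Eventually.of_forall fun z => ((hi z k).const_mul z).aestronglyMeasurable)
    ((hi y k).const_mul y)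
    (((hi y k).sub (hi y (k + 1))).const_mul _).aestronglyMeasurable ?_
    ((hgi.abs.const_mul 2).const_mul _) ?_).2
  · simp only [integral_const_mul] at h
    rw [integral_sub (hi y k) (hi y (k + 1))] at h
    convert! h using 1
    simp only [szkMoment]
    field_simp
  · filter_upwards [ae_restrict_mem measurableSet_Ioi] with t ht z hz
    have a1 := szk_nonneg (le_of_lt hz) (le_of_lt ht) k
    have a2 := szk_nonneg (le_of_lt hz) (le_of_lt ht) (k + 1)
    have b1 := szk_le_one (le_of_lt hz) (le_of_lt ht) k
    have b2 := szk_le_one (le_of_lt hz) (le_of_lt ht) (k + 1)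
    rw [← sub_mul, norm_mul, norm_mul, Real.norm_eq_abs, Real.norm_eq_abs, Real.norm_eq_abs]
    gcongr
    rw [abs_le]
    constructor <;> linarith
  · refine Eventually.of_forall fun t z hz => ?_
    have e := ((hasDerivAt_id z).mul ((hasDerivAt_szk_left z k t).mul_const (g t)))
    convert! e using 1
    have m1 := mul_szk z (k - 1) t
    have m2 := mul_szk z k t
    simp only [sub_add_cancel, Int.cast_sub, Int.cast_one] at m1
    simp only [id]
    linear_combination (-g t) * (m1 - m2)

theorem szk_natCast_le {y Z x : ℝ} (hy : 0 ≤ y) (hx : 0 ≤ x) (hZ : y * x ≤ Z) (k : ℕ) :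
    szk y k x ≤ Z ^ k / k.factorial := by
  rw [szk_natCast]
  have h1 : Real.exp (-y * x) ≤ 1 := Real.exp_le_one_iff.2 (by nlinarith [mul_nonneg hy hx])
  calc _ ≤ (y * x) ^ k / k.factorial * 1 := by gcongr
    _ ≤ _ := by rw [mul_one]; gcongr

theorem summable_mul_pow_div_factorial (Z : ℝ) :
    Summable fun k : ℕ => (k : ℝ) * (Z ^ k / k.factorial) := by
  rw [← summable_nat_add_iff 1]
  refine ((Real.summable_pow_div_factorial Z).mul_left Z).congr fun k => ?_
  rw [Nat.factorial_succ]
  push_cast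
  have : (k.factorial : ℝ) ≠ 0 := by positivity
  have : (k : ℝ) + 1 ≠ 0 := by positivity
  field_simp
  ring

theorem summable_mul_szk_mul {y x M : ℝ} (hy : 0 ≤ y) (hx : 0 ≤ x) (a : ℕ) {v : ℕ → ℝ}
    (hv : ∀ m, |v m| ≤ M) :
    Summable fun m : ℕ => ((m + a : ℕ) : ℝ) * szk y ((m + a : ℕ) : ℤ) x * v m := by
  refine Summable.of_norm_bounded
    (((summable_nat_add_iff a).2 (summable_mul_pow_div_factorial (y * x))).mul_right M)
    fun m => ?_
  have h := szk_natCast_le hy hx le_rfl (m + a)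
  have h0 := szk_nonneg hy hx ((m + a : ℕ) : ℤ)
  rw [norm_mul, Real.norm_eq_abs, Real.norm_eq_abs, abs_of_nonneg (by positivity)]
  gcongr
  exact hv m

theorem hasDerivAt_tsum_szkTerm {y x : ℝ} (hy : 0 < y) (hx : 0 < x) (j : ℤ) {g : ℝ → ℝ}
    (hg : ContDiff ℝ 2 g) (hc : HasCompactSupport g) (hs : tsupport g ⊆ Set.Ioi 0) :
    HasDerivAt (fun y => ∑' m, szkTerm y j x g m)
      (-(∑' m, szkTerm y j x (opD j g) m) / y ^ 2) y := by
  obtain ⟨M, hM⟩ := hc.exists_bound_of_continuous hg.continuous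
  have hcD : HasCompactSupport (opD j g) :=
    hc.mono' (subset_closure.trans (tsupport_opD_subset j g))
  obtain ⟨M', hM'⟩ := hcD.exists_bound_of_continuous (continuous_opD j hg)
  simp only [Real.norm_eq_abs] at hM hM'
  have hM0 : 0 ≤ M := (abs_nonneg _).trans (hM 0)
  have hI : ∀ z > 0, ∀ k, |szkMoment z k g| ≤ M := fun z hz k =>
    abs_szkMoment_le_of_bounded hz k hM0 fun t _ => hM t
  have sg : Summable (szkTerm y j x g) :=
    (szkSummable_of_abs_le_exp (K := M) hy hy hx.le j hg.continuous.aestronglyMeasurable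
      fun t _ => by simpa using hM t).2
  have sD : Summable (szkTerm y j x (opD j g)) :=
    (szkSummable_of_abs_le_exp (K := M') hy hy hx.le j (continuous_opD j hg).aestronglyMeasurable
      fun t _ => by simpa using hM' t).2
  set a := j.toNat with ha
  have haj : ∀ m : ℕ, max 0 j + (m : ℤ) = ((m + a : ℕ) : ℤ) := fun m => by push_cast; omega
  have hnn : ∀ m : ℕ, (0 : ℝ) ≤ ((m + a : ℕ) : ℝ) - j + 1 := fun m => by
    have : (0 : ℤ) ≤ ((m + a : ℕ) : ℤ) - j + 1 := by omega
    exact_mod_cast this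
  set g' : ℕ → ℝ → ℝ := fun m z =>
    (((m + a : ℕ) : ℝ) * szk z ((m + a : ℕ) : ℤ) x
      - (((m + a : ℕ) : ℝ) + 1) * szk z (((m + a : ℕ) : ℤ) + 1) x) / z
      * szkMoment z (((m + a : ℕ) : ℤ) - j) g
    + szk z ((m + a : ℕ) : ℤ) x * ((((m + a : ℕ) : ℝ) - j + 1) / z
      * (szkMoment z (((m + a : ℕ) : ℤ) - j) g - szkMoment z (((m + a : ℕ) : ℤ) - j + 1) g))
    with hg'
  have hterm : ∀ m z, 0 < z → HasDerivAt (fun z => szkTerm z j x g m) (g' m z) z := by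
    intro m z hz
    simp only [szkTerm, haj]
    convert! (hasDerivAt_szk_left z ((m + a : ℕ) : ℤ) x).mul
      (hasDerivAt_szkMoment hz (((m + a : ℕ) : ℤ) - j) hg.continuous hc) using 1
    have m1 := mul_szk z (((m + a : ℕ) : ℤ) - 1) x
    have m2 := mul_szk z ((m + a : ℕ) : ℤ) x
    simp only [sub_add_cancel, Int.cast_sub, Int.cast_one, Int.cast_natCast] at m1 m2
    simp only [hg', Int.cast_sub, Int.cast_natCast]
    rw [← m1, ← m2]
    field_simp
  set Z := 2 * y * x with hZ
  set u : ℕ → ℝ := fun k => Z ^ k / k.factorial with hu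
  have hu1 : Summable fun m : ℕ => u (m + a) :=
    (summable_nat_add_iff a).2 (Real.summable_pow_div_factorial Z)
  have hu2 : Summable fun m : ℕ => ((m + a : ℕ) : ℝ) * u (m + a) :=
    (summable_nat_add_iff a).2 (summable_mul_pow_div_factorial Z)
  have hu3 : Summable fun m : ℕ => (((m + a : ℕ) : ℝ) + 1) * u (m + a + 1) := by
    have := (summable_nat_add_iff (a + 1)).2 (summable_mul_pow_div_factorial Z)
    refine this.congr fun m => ?_
    rw [← add_assoc]
    push_cast
    rfl
  have hbd : Summable fun m : ℕ => (((m + a : ℕ) : ℝ) * u (m + a)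
      + (((m + a : ℕ) : ℝ) + 1) * u (m + a + 1)) / (y / 2) * M
      + u (m + a) * ((((m + a : ℕ) : ℝ) - j + 1) / (y / 2) * (M + M)) := by
    refine (((hu2.add hu3).div_const _).mul_right M).add ?_
    refine ((hu2.add (hu1.mul_right (1 - j : ℝ))).mul_right ((M + M) / (y / 2))).congr fun m => ?_
    ring
  have hder := hasDerivAt_tsum_of_isPreconnected (g := fun m z => szkTerm z j x g m) (g' := g')
    (t := Set.Ioo (y / 2) (2 * y)) (y₀ := y) (y := y) hbd isOpen_Ioo isPreconnected_Ioo
    (fun m z hz => hterm m z (by linarith [hz.1])) ?_ ⟨by linarith, by linarith⟩ sg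
    ⟨by linarith, by linarith⟩
  · convert! hder using 1
    set w : ℕ → ℝ := fun m => ((m + a : ℕ) : ℝ) * szk y ((m + a : ℕ) : ℤ) x *
      szkMoment y (((m + a : ℕ) : ℤ) - j - 1) g with hw
    have sw : Summable w := summable_mul_szk_mul hy.le hx.le a fun m => hI y hy _
    have sw1 : Summable fun m => w (m + 1) := (summable_nat_add_iff 1).2 sw
    have hw0 : w 0 = 0 := by
      simp only [hw, zero_add]
      rcases le_or_gt j 0 with hj | hj
      · have : a = 0 := by omega
        simp [this]
      · rw [szkMoment_of_neg (by omega), mul_zero]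
    have htel : ∑' m, (w m - w (m + 1)) = 0 := by
      rw [sw.tsum_sub sw1, sw.tsum_eq_zero_add, hw0]
      ring
    have hid : ∀ m, g' m y = (w m - w (m + 1)) / y - szkTerm y j x (opD j g) m / y ^ 2 := by
      intro m
      simp only [szkTerm, haj, szkMoment_opD y _ j hg hc hs, hg', hw]
      have e1 : ((m + 1 + a : ℕ) : ℤ) = ((m + a : ℕ) : ℤ) + 1 := by push_cast; ring
      have e2 : ((m + 1 + a : ℕ) : ℝ) = ((m + a : ℕ) : ℝ) + 1 := by push_cast; ring
      rw [e1, e2, show ((m + a : ℕ) : ℤ) + 1 - j - 1 = ((m + a : ℕ) : ℤ) - j by ring]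
      simp only [Int.cast_sub, Int.cast_natCast]
      field_simp
      ring
    rw [tsum_congr hid, ((sw.sub sw1).div_const y).tsum_sub (sD.div_const _), tsum_div_const, htel,
      tsum_div_const]
    ring
  · intro m z hz
    have hz0 : 0 < z := by linarith [hz.1]
    have hzx : z * x ≤ Z := by rw [hZ]; nlinarith [hz.2]
    have c1 := szk_natCast_le hz0.le hx.le hzx (m + a)
    have c2 := szk_natCast_le hz0.le hx.le hzx (m + a + 1)
    have n1 := szk_nonneg hz0.le hx.le ((m + a : ℕ) : ℤ)
    have n2 := szk_nonneg hz0.le hx.le (((m + a : ℕ) : ℤ) + 1)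
    have e1 : ((m + a + 1 : ℕ) : ℤ) = ((m + a : ℕ) : ℤ) + 1 := by push_cast; ring
    rw [e1] at c2
    have i1 := hI z hz0 (((m + a : ℕ) : ℤ) - j)
    have i2 := hI z hz0 (((m + a : ℕ) : ℤ) - j + 1)
    have hn := hnn m
    have hu0 : 0 ≤ u (m + a) := n1.trans c1
    have hu0' : 0 ≤ u (m + a + 1) := n2.trans c2
    have hy2 : 0 < y / 2 := half_pos hy
    simp only [hg']
    refine (norm_add_le _ _).trans ?_
    simp only [norm_mul, norm_div, Real.norm_eq_abs, abs_of_pos hz0, abs_of_nonneg n1,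
      abs_of_nonneg hn]
    refine add_le_add ?_ ?_
    · gcongr ?_ / ?_ * ?_
      · refine (abs_sub _ _).trans ?_
        rw [abs_of_nonneg (by positivity), abs_of_nonneg (by positivity)]
        gcongr
      · exact hz.1.le
    · gcongr ?_ * (_ / ?_ * ?_)
      · exact hz.1.le
      · exact (abs_sub _ _).trans (add_le_add i1 i2)

theorem abs_sub_le_of_abs_deriv_le_exp {G G' : ℝ → ℝ} {L C κ Y : ℝ} (hκ : 0 < κ)
    (hG : ∀ y ≥ Y, HasDerivAt G (G' y) y) (hG' : ∀ y ≥ Y, |G' y| ≤ C * Real.exp (-κ * y))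
    (hL : Tendsto G atTop (nhds L)) : ∀ y ≥ Y, |G y - L| ≤ C / κ * Real.exp (-κ * y) := by
  have hE : ∀ y, HasDerivAt (fun y => C / κ * Real.exp (-κ * y)) (-(C * Real.exp (-κ * y))) y := by
    intro y
    convert! (((hasDerivAt_id y).const_mul (-κ)).exp.const_mul (C / κ)) using 1
    simp only [id]
    field_simp
  have hlim : Tendsto (fun y => C / κ * Real.exp (-κ * y)) atTop (nhds 0) := by
    simpa using (isLittleO_exp_neg_mul_rpow_atTop hκ 0).const_mul_left (C / κ)
  have main : ∀ (H H' : ℝ → ℝ) (l : ℝ), (∀ y ≥ Y, HasDerivAt H (H' y) y) →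
      (∀ y ≥ Y, H' y ≤ C * Real.exp (-κ * y)) → Tendsto H atTop (nhds l) →
      ∀ y ≥ Y, l - H y ≤ C / κ * Real.exp (-κ * y) := by
    intro H H' l h1 h2 h3 y hy
    have hd : ∀ z ≥ Y, HasDerivAt (fun z => H z + C / κ * Real.exp (-κ * z)) _ z := fun z hz =>
      (h1 z hz).add (hE z)
    have hanti : AntitoneOn (fun z => H z + C / κ * Real.exp (-κ * z)) (Set.Ici Y) := by
      refine antitoneOn_of_deriv_nonpos (convex_Ici Y)
        (fun z hz => (hd z hz).continuousAt.continuousWithinAt)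
        (fun z hz => (hd z (interior_subset hz)).differentiableAt.differentiableWithinAt)
        fun z hz => ?_
      have hz' : z ≥ Y := interior_subset hz
      rw [(hd z hz').deriv]
      linarith [h2 z hz']
    have := le_of_tendsto (h3.add hlim) (Filter.eventually_atTop.2
      ⟨y, fun z hz => hanti hy (hy.le.trans hz) hz⟩)
    linarith
  intro y hy
  rw [abs_le]
  have A1 := main G G' L hG (fun z hz => (le_abs_self _).trans (hG' z hz)) hL y hy
  have A2 := main (fun z => -G z) (fun z => -G' z) (-L) (fun z hz => (hG z hz).neg)
    (fun z hz => (neg_le_abs _).trans (hG' z hz)) hL.neg y hy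
  constructor <;> linarith

theorem exists_cutoff {h : ℝ → ℝ} (hC2 : ContDiffOn ℝ 2 h (Set.Ioi 0)) {x : ℝ} (hx : 0 < x) :
    ∃ g : ℝ → ℝ, ContDiff ℝ 2 g ∧ HasCompactSupport g ∧ tsupport g ⊆ Set.Ioi 0 ∧
      (∀ t, |t - x| < x / 4 → g t = h t) ∧ ∀ t, |h t - g t| ≤ |h t| := by
  let b : ContDiffBump x := ⟨x / 4, x / 2, by positivity, by linarith⟩
  have hbs : tsupport b ⊆ Set.Ioi 0 := by
    rw [b.tsupport_eq]
    intro t ht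
    rw [Metric.mem_closedBall, Real.dist_eq, abs_le] at ht
    have : b.rOut = x / 2 := rfl
    rw [Set.mem_Ioi]
    linarith [ht.1]
  have hs : tsupport (fun t => b t * h t) ⊆ tsupport b := tsupport_mul_subset_left
  refine ⟨fun t => b t * h t, ?_, b.hasCompactSupport.mul_right, hs.trans hbs, ?_, ?_⟩
  · rw [contDiff_iff_contDiffAt]
    intro t
    by_cases ht : t ∈ tsupport b
    · exact b.contDiff.contDiffAt.mul (hC2.contDiffAt (Ioi_mem_nhds (hbs ht)))
    · have : (fun t => b t * h t) =ᶠ[nhds t] fun _ => 0 := by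
        filter_upwards [(isClosed_tsupport b).isOpen_compl.mem_nhds ht] with s hs'
        rw [image_eq_zero_of_notMem_tsupport hs', zero_mul]
      exact contDiffAt_const.congr_of_eventuallyEq this
  · intro t ht
    have : b t = 1 := b.one_of_mem_closedBall (by
      rw [Metric.mem_closedBall, Real.dist_eq]
      exact ht.le)
    simp only [this, one_mul]
  · intro t
    rw [show h t - b t * h t = (1 - b t) * h t by ring, abs_mul,
      abs_of_nonneg (sub_nonneg.2 b.le_one)]
    nlinarith [abs_nonneg (h t), b.nonneg (x := t)]

/-- If `g` satisfies `D_j² g = p g` near `x`, then `S_{n,j} g` agrees at `x` with `e^{p/n} g` up to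
an exponentially small error. -/
theorem exists_abs_tsum_szkTerm_sub_le {x δ p : ℝ} (hx : 0 < x) (hδ : 0 < δ) (j : ℤ) {g : ℝ → ℝ}
    (hg : ContDiff ℝ 2 g) (hc : HasCompactSupport g) (hs : tsupport g ⊆ Set.Ioi 0)
    (heig : ∀ t, |t - x| < δ → opD j g t = p * g t) :
    ∃ C κ : ℝ, 0 < κ ∧ ∀ᶠ y : ℝ in atTop,
      |∑' m, szkTerm y j x g m - Real.exp (p / y) * g x| ≤ C * Real.exp (-κ * y) := by
  have hcD : HasCompactSupport (opD j g) :=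
    hc.mono' (subset_closure.trans (tsupport_opD_subset j g))
  set r : ℝ → ℝ := fun t => opD j g t + (-p) * g t with hr
  have hDc : Continuous (opD j g) := continuous_opD j hg
  have hgc : Continuous g := hg.continuous
  have hrc : Continuous r := by fun_prop
  obtain ⟨M, hM⟩ := hc.exists_bound_of_continuous hgc
  obtain ⟨M', hM'⟩ := hcD.exists_bound_of_continuous hDc
  simp only [Real.norm_eq_abs] at hM hM'
  have hM0 : 0 ≤ M := (abs_nonneg _).trans (hM 0)
  have hM'0 : 0 ≤ M' := (abs_nonneg _).trans (hM' 0)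
  have hrM : ∀ t, |r t| ≤ M' + |p| * M := fun t => by
    refine (abs_add_le _ _).trans (add_le_add (hM' t) ?_)
    rw [abs_mul, abs_neg]
    gcongr
    exact hM t
  obtain ⟨C, κ, hκ, hC⟩ := exists_abs_tsum_szkTerm_le (A := 0) (K := M' + |p| * M) hx hδ le_rfl
    (by positivity) j (f := r) hrc.aestronglyMeasurable (fun t _ => by simpa using hrM t)
    fun t ht => by simp [hr, heig t ht]
  obtain ⟨Y, hY⟩ := Filter.eventually_atTop.1 (hC.and (eventually_ge_atTop 1))
  have hlimG : Tendsto (fun y => Real.exp (-p / y) * ∑' m, szkTerm y j x g m) atTop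
      (nhds (g x)) := by
    have h1 : Tendsto (fun y : ℝ => Real.exp (-p / y)) atTop (nhds 1) := by
      have := (Real.continuous_exp.tendsto 0).comp (tendsto_const_nhds (x := -p).div_atTop tendsto_id)
      simpa [Function.comp_def] using this
    simpa using h1.mul (tendsto_tsum_szkTerm hx j hgc hM)
  have hexp : ∀ q : ℝ, ∀ y ≥ 1, Real.exp (q / y) ≤ Real.exp |q| := by
    intro q y hy
    gcongr
    calc q / y ≤ |q| / y := by gcongr; exact le_abs_self q
      _ ≤ |q| := div_le_self (abs_nonneg q) hy
  have key := abs_sub_le_of_abs_deriv_le_exp (Y := Y) (C := Real.exp |p| * C) (L := g x) hκ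
    (G := fun y => Real.exp (-p / y) * ∑' m, szkTerm y j x g m)
    (G' := fun y => -(Real.exp (-p / y) * ∑' m, szkTerm y j x r m) / y ^ 2) ?_ ?_ hlimG
  · refine ⟨Real.exp |p| * (Real.exp |p| * C / κ), κ, hκ, ?_⟩
    filter_upwards [eventually_ge_atTop Y] with y hy
    have hy1 := (hY y hy).2
    have e : ∑' m, szkTerm y j x g m - Real.exp (p / y) * g x = Real.exp (p / y) *
        (Real.exp (-p / y) * ∑' m, szkTerm y j x g m - g x) := by
      rw [mul_sub, ← mul_assoc, ← Real.exp_add, neg_div, add_neg_cancel, Real.exp_zero, one_mul]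
    rw [e, abs_mul, abs_of_pos (Real.exp_pos _), mul_assoc]
    exact mul_le_mul (hexp p y hy1) (key y hy) (abs_nonneg _) (Real.exp_pos _).le
  · intro y hy
    have hy0 : 0 < y := by linarith [(hY y hy).2]
    have sg : SzkSummable y j x g := szkSummable_of_abs_le_exp (K := M) hy0 hy0 hx.le j
      hgc.aestronglyMeasurable fun t _ => by simpa using hM t
    have sD : SzkSummable y j x (opD j g) := szkSummable_of_abs_le_exp (K := M') hy0 hy0 hx.le j
      hDc.aestronglyMeasurable fun t _ => by simpa using hM' t
    have hR := (sD.add (sg.const_mul (-p))).2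
    simp only [szkTerm_const_mul, tsum_mul_left] at hR
    have hE : HasDerivAt (fun y : ℝ => Real.exp (-p / y)) (Real.exp (-p / y) * (p / y ^ 2)) y := by
      convert! ((hasDerivAt_const y (-p)).div (hasDerivAt_id y) hy0.ne').exp using 1
      simp
    convert! hE.mul (hasDerivAt_tsum_szkTerm hy0 hx j hg hc hs) using 1
    rw [hr, hR]
    ring
  · intro y hy
    obtain ⟨h1, h2⟩ := hY y hy
    have hy0 : 0 < y := by linarith
    rw [abs_div, abs_neg, abs_mul, abs_of_pos (Real.exp_pos _), abs_of_pos (pow_pos hy0 2)]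
    refine (div_le_self (by positivity) (one_le_pow₀ h2)).trans ?_
    rw [mul_assoc]
    have h3 := hexp (-p) y h2
    rw [abs_neg] at h3
    exact mul_le_mul h3 h1 (abs_nonneg _) (Real.exp_pos _).le

theorem isLittleO_of_eventually_abs_le_exp {F : ℝ → ℝ} {C κ : ℝ} (hκ : 0 < κ)
    (h : ∀ᶠ y : ℝ in atTop, |F y| ≤ C * Real.exp (-κ * y)) (c : ℝ) :
    F =o[atTop] fun y : ℝ => y ^ c := by
  refine IsBigO.trans_isLittleO (g := fun y => Real.exp (-κ * y)) ?_
    (isLittleO_exp_neg_mul_rpow_atTop hκ c)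
  exact IsBigO.of_bound C (h.mono fun y hy => by simpa using hy)

/-- If `h` is an eigenfunction of `D_j²` with eigenvalue `p`, then
`(S_{n,j} h)(x) = e^{p/n} h(x) + o(n^{-c})` as `n → ∞`, for every `c > 0`. -/
theorem eigenfunction_D2_asymptotic (j : ℤ) (p : ℝ) (h : ℝ → ℝ)
    (hE : ∃ A ≥ (0:ℝ), MemEA A h) (hC2 : ContDiffOn ℝ 2 h (Set.Ioi 0))
    (heig : ∀ x > (0:ℝ), (1 - j) * deriv h x + x * deriv (deriv h) x = p * h x) :
    ∀ x > (0:ℝ), ∀ c > (0:ℝ),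
      (fun n : ℕ => Snj n j h x - Real.exp (p / n) * h x)
        =o[atTop] fun n : ℕ => (n : ℝ) ^ (-c) := by
  intro x hx c _
  obtain ⟨A, hA, -, K, hK, hbd⟩ := hE
  obtain ⟨g, hg, hgc, hgs, hgh, hle⟩ := exists_cutoff hC2 hx
  have hδ : 0 < x / 4 := by positivity
  have hgeig : ∀ t, |t - x| < x / 4 → opD j g t = p * g t := by
    intro t ht
    have ht0 : 0 < t := by linarith [(abs_lt.1 ht).1]
    have hnear : g =ᶠ[nhds t] h := by
      filter_upwards [(isOpen_lt (continuous_id.sub continuous_const).abs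
        continuous_const).mem_nhds ht] with s hs
      exact hgh s hs
    rw [opD, hnear.deriv_eq, hnear.deriv.deriv_eq, hnear.eq_of_nhds, heig t ht0]
  obtain ⟨C1, κ1, hκ1, h1⟩ := exists_abs_tsum_szkTerm_sub_le hx hδ j hg hgc hgs hgeig
  have hmeas : AEStronglyMeasurable (fun t => h t - g t) (volume.restrict (Set.Ioi 0)) :=
    (hC2.continuousOn.sub hg.continuous.continuousOn).aestronglyMeasurable measurableSet_Ioi
  have hdiff : ∀ t > 0, |h t - g t| ≤ K * Real.exp (A * t) := fun t ht =>
    (hle t).trans (hbd t (le_of_lt ht))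
  obtain ⟨C2, κ2, hκ2, h2⟩ := exists_abs_tsum_szkTerm_le hx hδ hA hK.le j hmeas hdiff
    fun t ht => by rw [hgh t ht, sub_self]
  obtain ⟨M, hM⟩ := hgc.exists_bound_of_continuous hg.continuous
  have hreal : (fun y : ℝ => Snj y j h x - Real.exp (p / y) * h x)
      =o[atTop] fun y : ℝ => y ^ (-c) := by
    refine ((((sum_szk_isLittleO j.toNat hx c).const_mul_left (h 0)).add
      (isLittleO_of_eventually_abs_le_exp hκ2 h2 (-c))).add
      (isLittleO_of_eventually_abs_le_exp hκ1 h1 (-c))).congr' ?_ (EventuallyEq.refl _ _)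
    filter_upwards [eventually_gt_atTop A] with y hy
    have hy0 : 0 < y := hA.trans_lt hy
    have sd := szkSummable_of_abs_le_exp hy0 hy hx.le j hmeas hdiff
    have sg : SzkSummable y j x g := szkSummable_of_abs_le_exp (K := M) hy0 hy0 hx.le j
      hg.continuous.aestronglyMeasurable fun t _ => by simpa using hM t
    have hsum := (sd.add sg).2
    simp only [sub_add_cancel] at hsum
    rw [Snj_eq, hsum, hgh x (by simpa using hδ)]
    ring
  exact hreal.comp_tendsto tendsto_natCast_atTop_atTop
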